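/- arXiv:math/0307270 — 2 statements merged into one kernel-verified Lean document; each statement's English description precedes it below -/
import Mathlib

section
/- Let x₀, y₀ > 0 and D = [0,x₀]×[0,y₀]. Let f, g : ℝ² → ℝ be smooth and globally Lipschitz, and let U₀ : [0,x₀] → ℝ and V₀ : [0,y₀] → ℝ be smooth. Then there exists exactly one pair of continuously differentiable functions U, V : D → ℝ satisfying ∂ₓV(x,y) = f(U(x,y), V(x,y)) and ∂_yU(x,y) = g(U(x,y), V(x,y)) for all (x,y) ∈ D, together with the initial conditions U(x,0) = U₀(x) for all x ∈ [0,x₀] and V(0,y) = V₀(y) for all y ∈ [0,y₀]. -/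
/-- `IsGoursatSolution x₀ y₀ f g U₀ V₀ U V` says that the pair `(U, V)` is a continuously
differentiable solution on the rectangle `D = [0,x₀] × [0,y₀]` of the nonlinear hyperbolic
system `∂ₓV = f(U,V)`, `∂_yU = g(U,V)` with the initial conditions `U(x,0) = U₀(x)` and
`V(0,y) = V₀(y)`. -/
def IsGoursatSolution (x₀ y₀ : ℝ) (f g : ℝ → ℝ → ℝ) (U₀ V₀ : ℝ → ℝ)
    (U V : ℝ → ℝ → ℝ) : Prop :=
  ContDiffOn ℝ 1 (fun p : ℝ × ℝ => U p.1 p.2) (Set.Icc 0 x₀ ×ˢ Set.Icc 0 y₀) ∧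
  ContDiffOn ℝ 1 (fun p : ℝ × ℝ => V p.1 p.2) (Set.Icc 0 x₀ ×ˢ Set.Icc 0 y₀) ∧
  (∀ x ∈ Set.Icc (0:ℝ) x₀, ∀ y ∈ Set.Icc (0:ℝ) y₀,
    HasDerivWithinAt (fun x' => V x' y) (f (U x y) (V x y)) (Set.Icc 0 x₀) x ∧
    HasDerivWithinAt (fun y' => U x y') (g (U x y) (V x y)) (Set.Icc 0 y₀) y) ∧
  (∀ x ∈ Set.Icc (0:ℝ) x₀, U x 0 = U₀ x) ∧
  (∀ y ∈ Set.Icc (0:ℝ) y₀, V 0 y = V₀ y)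

open Set Filter Topology

theorem abs_sub_sub_mul_le_of_hasDerivWithinAt {φ φ' : ℝ → ℝ} {s : Set ℝ} {m C a b : ℝ}
    (hs : Convex ℝ s) (hφ : ∀ t ∈ s, HasDerivWithinAt φ (φ' t) s t)
    (hC : ∀ t ∈ s, |φ' t - m| ≤ C) (ha : a ∈ s) (hb : b ∈ s) :
    |φ b - φ a - m * (b - a)| ≤ C * |b - a| := by
  have h := Convex.norm_image_sub_le_of_norm_hasDerivWithin_le (f := fun t => φ t - m * t)
    (f' := fun t => φ' t - m) (C := C) (s := s)
    (fun t ht => by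
      simpa using! (hφ t ht).sub ((hasDerivWithinAt_id t s).const_mul m)) hC hs ha hb
  simp only [Real.norm_eq_abs] at h
  rwa [show φ b - φ a - m * (b - a) = φ b - m * b - (φ a - m * a) by ring]

theorem HasDerivWithinAt.Ici_of_Icc {φ : ℝ → ℝ} {φ' S t : ℝ}
    (h : HasDerivWithinAt φ φ' (Icc 0 S) t) (ht : t ∈ Ico 0 S) :
    HasDerivWithinAt φ φ' (Ici t) t :=
  h.mono_of_mem_nhdsWithin (Icc_mem_nhdsGE_of_mem ht)

theorem abs_le_exp_of_abs_deriv_le_exp {φ φ' : ℝ → ℝ} {S c l : ℝ} (hl : 0 < l) (hc : 0 ≤ c)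
    (hφ : ∀ t ∈ Icc 0 S, HasDerivWithinAt φ (φ' t) (Icc 0 S) t) (h0 : φ 0 = 0)
    (hb : ∀ t ∈ Icc 0 S, |φ' t| ≤ c * Real.exp (l * t)) :
    ∀ t ∈ Icc 0 S, |φ t| ≤ c / l * Real.exp (l * t) := by
  intro t ht
  refine image_norm_le_of_norm_deriv_right_le_deriv_boundary (f := φ) (f' := φ') (a := 0) (b := S)
    (B := fun t => c / l * Real.exp (l * t)) (B' := fun t => c * Real.exp (l * t))
    (fun t ht => (hφ t ht).continuousWithinAt)
    (fun t ht => (hφ t (Ico_subset_Icc_self ht)).Ici_of_Icc ht) ?_ ?_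
    (fun t ht => hb t (Ico_subset_Icc_self ht)) ht
  · simp only [h0, norm_zero]
    positivity
  · intro t
    refine (((hasDerivAt_id t).const_mul l).exp.const_mul (c / l)).congr_deriv ?_
    simp only [id]
    field_simp

/-- A function on a rectangle with continuous partial derivatives is continuously
differentiable. -/
theorem contDiffOn_one_rectangle {T S : ℝ} (hT : 0 < T) (hS : 0 < S) {F Fx Fy : ℝ → ℝ → ℝ}
    (hFx : Continuous fun p : ℝ × ℝ => Fx p.1 p.2) (hFy : Continuous fun p : ℝ × ℝ => Fy p.1 p.2)
    (dx : ∀ x ∈ Icc 0 T, ∀ y ∈ Icc 0 S,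
      HasDerivWithinAt (fun x' => F x' y) (Fx x y) (Icc 0 T) x)
    (dy : ∀ x ∈ Icc 0 T, ∀ y ∈ Icc 0 S,
      HasDerivWithinAt (fun y' => F x y') (Fy x y) (Icc 0 S) y) :
    ContDiffOn ℝ 1 (fun p : ℝ × ℝ => F p.1 p.2) (Icc 0 T ×ˢ Icc 0 S) := by
  have hu : UniqueDiffOn ℝ (Icc 0 T ×ˢ Icc 0 S) :=
    (uniqueDiffOn_Icc hT).prod (uniqueDiffOn_Icc hS)
  rw [show (1 : WithTop ℕ∞) = 0 + 1 from rfl,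
    contDiffOn_succ_iff_hasFDerivWithinAt_of_uniqueDiffOn hu]
  refine ⟨by simp, fun p => Fx p.1 p.2 • ContinuousLinearMap.fst ℝ ℝ ℝ +
    Fy p.1 p.2 • ContinuousLinearMap.snd ℝ ℝ ℝ, ?_, ?_⟩
  · rw [contDiffOn_zero]
    exact ((hFx.smul continuous_const).add (hFy.smul continuous_const)).continuousOn
  rintro ⟨x, y⟩ ⟨hx, hy⟩
  simp only at hx hy
  rw [hasFDerivWithinAt_iff_isLittleO, Asymptotics.isLittleO_iff]
  intro c hc
  obtain ⟨δ₁, hδ₁, h₁⟩ := Metric.continuousAt_iff.1 (hFx.continuousAt (x := (x, y))) (c / 2)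
    (by positivity)
  obtain ⟨δ₂, hδ₂, h₂⟩ := Metric.continuousAt_iff.1 (hFy.continuousAt (x := (x, y))) (c / 2)
    (by positivity)
  filter_upwards [self_mem_nhdsWithin,
    mem_nhdsWithin_of_mem_nhds (Metric.ball_mem_nhds (x, y) hδ₁),
    mem_nhdsWithin_of_mem_nhds (Metric.ball_mem_nhds (x, y) hδ₂)]
  rintro ⟨x', y'⟩ ⟨hx', hy'⟩ hb₁ hb₂
  simp only [Metric.mem_ball, Prod.dist_eq, max_lt_iff] at hx' hy' hb₁ hb₂ h₁ h₂
  have e₁ := abs_sub_sub_mul_le_of_hasDerivWithinAt (φ := fun t => F t y') (m := Fx x y)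
    (φ' := fun t => Fx t y') (C := c / 2)
    (s := Icc 0 T ∩ Metric.ball x δ₁) ((convex_Icc _ _).inter (convex_ball _ _))
    (fun t ht => (dx t ht.1 y' hy').mono inter_subset_left)
    (fun t ht => (h₁ (x := (t, y')) ⟨ht.2, hb₁.2⟩).le) (a := x) (b := x')
    ⟨hx, Metric.mem_ball_self hδ₁⟩ ⟨hx', hb₁.1⟩
  have e₂ := abs_sub_sub_mul_le_of_hasDerivWithinAt (φ := fun t => F x t) (m := Fy x y)
    (φ' := fun t => Fy x t) (C := c / 2)
    (s := Icc 0 S ∩ Metric.ball y δ₂) ((convex_Icc _ _).inter (convex_ball _ _))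
    (fun t ht => (dy x hx t ht.1).mono inter_subset_left)
    (fun t ht => (h₂ (x := (x, t)) ⟨by simpa using hδ₂, ht.2⟩).le) (a := y) (b := y')
    ⟨hy, Metric.mem_ball_self hδ₂⟩ ⟨hy', hb₂.2⟩
  have n₁ : |x' - x| ≤ ‖(x', y') - (x, y)‖ := norm_fst_le ((x', y') - (x, y))
  have n₂ : |y' - y| ≤ ‖(x', y') - (x, y)‖ := norm_snd_le ((x', y') - (x, y))
  simp only [Real.norm_eq_abs, Prod.mk_sub_mk, add_apply,
    smul_apply, ContinuousLinearMap.coe_fst', ContinuousLinearMap.coe_snd',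
    smul_eq_mul] at n₁ n₂ ⊢
  rw [show F x' y' - F x y - (Fx x y * (x' - x) + Fy x y * (y' - y)) =
    (F x' y' - F x y' - Fx x y * (x' - x)) + (F x y' - F x y - Fy x y * (y' - y)) by ring]
  refine (abs_add_le _ _).trans ?_
  nlinarith

theorem exists_continuous_goursat_solution {T S : ℝ} (hT : 0 < T) (hS : 0 < S)
    {F G : ℝ × ℝ → ℝ} {KF KG : NNReal} (hF : LipschitzWith KF F) (hG : LipschitzWith KG G)
    {u v : ℝ → ℝ} (hu : ContinuousOn u (Icc 0 T)) (hv : ContinuousOn v (Icc 0 S)) :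
    ∃ U V : ℝ → ℝ → ℝ, (Continuous fun p : ℝ × ℝ => U p.1 p.2) ∧
      (Continuous fun p : ℝ × ℝ => V p.1 p.2) ∧
      (∀ x ∈ Icc 0 T, ∀ y ∈ Icc 0 S,
        HasDerivWithinAt (fun x' => V x' y) (F (U x y, V x y)) (Icc 0 T) x ∧
        HasDerivWithinAt (fun y' => U x y') (G (U x y, V x y)) (Icc 0 S) y) ∧
      (∀ x ∈ Icc 0 T, U x 0 = u x) ∧ (∀ y ∈ Icc 0 S, V 0 y = v y) := by
  set K : ℝ := KF + KG with hK
  set l : ℝ := 2 * K + 1 with hl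
  have hK0 : 0 ≤ K := by positivity
  have hl0 : 0 < l := by positivity
  let e : C(↥(Icc 0 T) × ↥(Icc 0 S), ℝ × ℝ) → ℝ → ℝ → ℝ × ℝ := fun z x y =>
    Real.exp (l * (x + y)) • z (projIcc 0 T hT.le x, projIcc 0 S hS.le y)
  have he : ∀ z, Continuous fun p : ℝ × ℝ => e z p.1 p.2 := fun z => by
    have h1 : Continuous fun p : ℝ × ℝ => projIcc 0 T hT.le p.1 :=
      continuous_projIcc.comp continuous_fst
    have h2 : Continuous fun p : ℝ × ℝ => projIcc 0 S hS.le p.2 :=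
      continuous_projIcc.comp continuous_snd
    have h3 := z.continuous.comp (h1.prodMk h2)
    exact (show Continuous fun p : ℝ × ℝ => Real.exp (l * (p.1 + p.2)) by fun_prop).smul h3
  have heD : ∀ z z' x y, ‖e z x y - e z' x y‖ ≤ Real.exp (l * (x + y)) * dist z z' := by
    intro z z' x y
    simp only [e]
    rw [← smul_sub, norm_smul, Real.norm_eq_abs, abs_of_pos (Real.exp_pos _), ← dist_eq_norm]
    gcongr
    exact ContinuousMap.dist_apply_le_dist _
  have cG : ∀ z, Continuous fun p : ℝ × ℝ => G (e z p.1 p.2) := fun z =>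
    hG.continuous.comp (he z)
  have cF : ∀ z, Continuous fun p : ℝ × ℝ => F (e z p.1 p.2) := fun z =>
    hF.continuous.comp (he z)
  have cG1 : ∀ z x, Continuous fun t => G (e z x t) := fun z x =>
    (cG z).comp (by fun_prop : Continuous fun t : ℝ => (x, t))
  have cF1 : ∀ z y, Continuous fun t => F (e z t y) := fun z y =>
    (cF z).comp (by fun_prop : Continuous fun t : ℝ => (t, y))
  have dG : ∀ z x y, HasDerivAt (fun y => ∫ t in (0:ℝ)..y, G (e z x t)) (G (e z x y)) y :=
    fun z x y => (cG1 z x).integral_hasStrictDerivAt 0 y |>.hasDerivAt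
  have dF : ∀ z x y, HasDerivAt (fun x => ∫ t in (0:ℝ)..x, F (e z t y)) (F (e z x y)) x :=
    fun z x y => (cF1 z y).integral_hasStrictDerivAt 0 x |>.hasDerivAt
  have cIG : ∀ z, Continuous fun p : ↥(Icc 0 T) × ↥(Icc 0 S) =>
      ∫ t in (0:ℝ)..p.2, G (e z p.1 t) := fun z => by
    refine intervalIntegral.continuous_parametric_intervalIntegral_of_continuous
      (f := fun (p : ↥(Icc 0 T) × ↥(Icc 0 S)) t => G (e z p.1 t)) ?_ (by fun_prop)
    exact (cG z).comp (by fun_prop :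
      Continuous fun q : (↥(Icc 0 T) × ↥(Icc 0 S)) × ℝ => ((q.1.1 : ℝ), q.2))
  have cIF : ∀ z, Continuous fun p : ↥(Icc 0 T) × ↥(Icc 0 S) =>
      ∫ t in (0:ℝ)..p.1, F (e z t p.2) := fun z => by
    refine intervalIntegral.continuous_parametric_intervalIntegral_of_continuous
      (f := fun (p : ↥(Icc 0 T) × ↥(Icc 0 S)) t => F (e z t p.2)) ?_ (by fun_prop)
    exact (cF z).comp (by fun_prop :
      Continuous fun q : (↥(Icc 0 T) × ↥(Icc 0 S)) × ℝ => (q.2, (q.1.2 : ℝ)))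
  have cu : Continuous fun p : ↥(Icc 0 T) × ↥(Icc 0 S) => u p.1 :=
    hu.domRestrict.comp continuous_fst
  have cv : Continuous fun p : ↥(Icc 0 T) × ↥(Icc 0 S) => v p.2 :=
    hv.domRestrict.comp continuous_snd
  let Φ : C(↥(Icc 0 T) × ↥(Icc 0 S), ℝ × ℝ) → C(↥(Icc 0 T) × ↥(Icc 0 S), ℝ × ℝ) := fun z =>
    ⟨fun p => Real.exp (-(l * (p.1 + p.2))) • (u p.1 + ∫ t in (0:ℝ)..p.2, G (e z p.1 t),
      v p.2 + ∫ t in (0:ℝ)..p.1, F (e z t p.2)),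
      (show Continuous fun p : ↥(Icc 0 T) × ↥(Icc 0 S) => Real.exp (-(l * (p.1 + p.2))) by
        fun_prop).smul ((cu.add (cIG z)).prodMk (cv.add (cIF z)))⟩
  have contr : ContractingWith (1 / 2) Φ := by
    refine ⟨by norm_num, LipschitzWith.of_dist_le_mul fun z z' => ?_⟩
    have hKl : K / l ≤ 1 / 2 := by
      rw [div_le_iff₀ hl0]; linarith
    have key : ∀ x y I : ℝ, |I| ≤ K * dist z z' * Real.exp (l * x) / l * Real.exp (l * y) →
        Real.exp (-(l * (x + y))) * |I| ≤ 1 / 2 * dist z z' := by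
      intro x y I h
      calc Real.exp (-(l * (x + y))) * |I|
          ≤ Real.exp (-(l * (x + y))) *
            (K * dist z z' * Real.exp (l * x) / l * Real.exp (l * y)) := by gcongr
        _ = K / l * dist z z' * (Real.exp (-(l * (x + y))) *
            (Real.exp (l * x) * Real.exp (l * y))) := by ring
        _ = K / l * dist z z' := by
            rw [← Real.exp_add, ← Real.exp_add,
              show -(l * (x + y)) + (l * x + l * y) = 0 by ring, Real.exp_zero, mul_one]
        _ ≤ 1 / 2 * dist z z' := by gcongr
    rw [ContinuousMap.dist_le (by positivity)]
    rintro ⟨⟨x, hx⟩, ⟨y, hy⟩⟩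
    rw [dist_eq_norm]
    simp only [Φ, ContinuousMap.coe_mk]
    rw [← smul_sub, norm_smul, Real.norm_eq_abs, abs_of_pos (Real.exp_pos _), Prod.mk_sub_mk,
      add_sub_add_left_eq_sub, add_sub_add_left_eq_sub, Prod.norm_mk, Real.norm_eq_abs,
      Real.norm_eq_abs, mul_max_of_nonneg _ _ (Real.exp_pos _).le]
    have lip : ∀ {H : ℝ × ℝ → ℝ} {k : NNReal}, LipschitzWith k H → (k : ℝ) ≤ K → ∀ x y,
        |H (e z x y) - H (e z' x y)| ≤ K * dist z z' * Real.exp (l * (x + y)) := by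
      intro H k hH hk x y
      calc |H (e z x y) - H (e z' x y)| ≤ k * ‖e z x y - e z' x y‖ := hH.norm_sub_le _ _
        _ ≤ K * (Real.exp (l * (x + y)) * dist z z') := by gcongr; exact heD z z' x y
        _ = _ := by ring
    refine max_le (key x y _ ?_) ?_
    · refine abs_le_exp_of_abs_deriv_le_exp hl0 (by positivity)
        (fun t _ => ((dG z x t).sub (dG z' x t)).hasDerivWithinAt) (by simp) (fun t _ => ?_) y hy
      rw [mul_assoc, ← Real.exp_add, ← mul_add]
      exact lip hG (by simp [hK]) x t
    · rw [add_comm x y]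
      refine key y x _ (abs_le_exp_of_abs_deriv_le_exp hl0 (by positivity)
        (fun t _ => ((dF z t y).sub (dF z' t y)).hasDerivWithinAt) (by simp) (fun t _ => ?_) x hx)
      rw [mul_assoc, ← Real.exp_add, ← mul_add, add_comm y t]
      exact lip hF (by simp [hK]) t y
  obtain ⟨z, hz⟩ : ∃ z, Φ z = z := ⟨_, contr.fixedPoint_isFixedPt⟩
  have hzD : ∀ x ∈ Icc 0 T, ∀ y ∈ Icc 0 S, e z x y = (u x + ∫ t in (0:ℝ)..y, G (e z x t),
      v y + ∫ t in (0:ℝ)..x, F (e z t y)) := by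
    intro x hx y hy
    have h := congrArg (fun w : C(↥(Icc 0 T) × ↥(Icc 0 S), ℝ × ℝ) => w (⟨x, hx⟩, ⟨y, hy⟩)) hz
    simp only [Φ, ContinuousMap.coe_mk] at h
    change Real.exp (l * (x + y)) • z _ = _
    rw [projIcc_of_mem _ hx, projIcc_of_mem _ hy, ← h, smul_smul, ← Real.exp_add,
      add_neg_cancel, Real.exp_zero, one_smul]
  refine ⟨fun x y => (e z x y).1, fun x y => (e z x y).2, (he z).fst, (he z).snd, ?_, ?_, ?_⟩
  · intro x hx y hy
    refine ⟨((dF z x y).const_add (v y)).hasDerivWithinAt.congr_of_mem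
      (fun t ht => congrArg Prod.snd (hzD t ht y hy)) hx,
      ((dG z x y).const_add (u x)).hasDerivWithinAt.congr_of_mem
      (fun t ht => congrArg Prod.fst (hzD x hx t ht)) hy⟩
  · intro x hx
    simp [hzD x hx 0 (left_mem_Icc.2 hS.le)]
  · intro y hy
    simp [hzD 0 (left_mem_Icc.2 hT.le) y hy]

theorem goursat_solution_unique {T S : ℝ} {f g : ℝ → ℝ → ℝ} {KF KG : NNReal}
    (hf : LipschitzWith KF fun p : ℝ × ℝ => f p.1 p.2)
    (hg : LipschitzWith KG fun p : ℝ × ℝ => g p.1 p.2) {u v : ℝ → ℝ} {U V U' V' : ℝ → ℝ → ℝ}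
    (h : IsGoursatSolution T S f g u v U V) (h' : IsGoursatSolution T S f g u v U' V') :
    ∀ x ∈ Icc (0 : ℝ) T, ∀ y ∈ Icc (0 : ℝ) S, U x y = U' x y ∧ V x y = V' x y := by
  obtain ⟨cU, cV, d, iU, iV⟩ := h
  obtain ⟨cU', cV', d', iU', iV'⟩ := h'
  intro x₁ hx₁ y₁ hy₁
  set K : ℝ := KF + KG with hK
  set l : ℝ := 2 * K + 1 with hl
  have hK0 : 0 ≤ K := by positivity
  have hl0 : 0 < l := by positivity
  let w : ℝ × ℝ → ℝ × ℝ := fun p => (U p.1 p.2 - U' p.1 p.2, V p.1 p.2 - V' p.1 p.2)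
  have cw : ContinuousOn (fun p : ℝ × ℝ => Real.exp (-(l * (p.1 + p.2))) * ‖w p‖)
      (Icc 0 T ×ˢ Icc 0 S) := by
    refine ContinuousOn.mul (by fun_prop) (ContinuousOn.norm ?_)
    exact (cU.continuousOn.sub cU'.continuousOn).prodMk (cV.continuousOn.sub cV'.continuousOn)
  obtain ⟨⟨x, y⟩, ⟨hx, hy⟩, hmax⟩ := (isCompact_Icc.prod isCompact_Icc).exists_isMaxOn
    ⟨(x₁, y₁), hx₁, hy₁⟩ cw
  simp only at hx hy
  set m := Real.exp (-(l * (x + y))) * ‖w (x, y)‖ with hm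
  have hm0 : 0 ≤ m := by positivity
  have hw : ∀ s ∈ Icc 0 T, ∀ t ∈ Icc 0 S, ‖w (s, t)‖ ≤ m * Real.exp (l * (s + t)) := by
    intro s hs t ht
    have : Real.exp (-(l * (s + t))) * ‖w (s, t)‖ ≤ m := hmax (mk_mem_prod hs ht)
    rwa [Real.exp_neg, inv_mul_le_iff₀ (Real.exp_pos _), mul_comm] at this
  have lip : ∀ {H : ℝ → ℝ → ℝ} {k : NNReal}, LipschitzWith k (fun p : ℝ × ℝ => H p.1 p.2) →
      (k : ℝ) ≤ K → ∀ s ∈ Icc 0 T, ∀ t ∈ Icc 0 S,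
      |H (U s t) (V s t) - H (U' s t) (V' s t)| ≤ K * m * Real.exp (l * (s + t)) := by
    intro H k hH hk s hs t ht
    calc |H (U s t) (V s t) - H (U' s t) (V' s t)| ≤ k * ‖w (s, t)‖ :=
          hH.norm_sub_le (U s t, V s t) (U' s t, V' s t)
      _ ≤ K * (m * Real.exp (l * (s + t))) := by gcongr; exact hw s hs t ht
      _ = _ := by ring
  have h1 := abs_le_exp_of_abs_deriv_le_exp (c := K * m * Real.exp (l * x)) hl0 (by positivity)
    (fun t ht => (d x hx t ht).2.sub (d' x hx t ht).2) (by simp [iU x hx, iU' x hx])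
    (fun t ht => by
      rw [mul_assoc, ← Real.exp_add, ← mul_add]
      exact lip hg (by simp [hK]) x hx t ht) y hy
  have h2 := abs_le_exp_of_abs_deriv_le_exp (c := K * m * Real.exp (l * y)) hl0 (by positivity)
    (fun t ht => (d t ht y hy).1.sub (d' t ht y hy).1) (by simp [iV y hy, iV' y hy])
    (fun t ht => by
      rw [mul_assoc, ← Real.exp_add, ← mul_add, add_comm y t]
      exact lip hf (by simp [hK]) t ht y hy) x hx
  have h3 : ‖w (x, y)‖ ≤ K * m / l * Real.exp (l * (x + y)) := by
    rw [mul_add, Real.exp_add]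
    refine max_le (h1.trans_eq ?_) (h2.trans_eq ?_) <;> ring
  have h4 : m ≤ K * m / l := by
    have : Real.exp (-(l * (x + y))) * ‖w (x, y)‖ ≤ K * m / l := by
      rwa [Real.exp_neg, inv_mul_le_iff₀ (Real.exp_pos _), mul_comm (Real.exp _)]
    exact this
  have h5 : m = 0 := by
    rw [le_div_iff₀ hl0] at h4
    nlinarith
  have h6 := hw x₁ hx₁ y₁ hy₁
  rw [h5, zero_mul, norm_le_zero_iff, Prod.mk_eq_zero, sub_eq_zero, sub_eq_zero] at h6
  exact h6

theorem IsCompact.exists_uniform_delta {α β : Type*} [PseudoMetricSpace α] [PseudoMetricSpace β]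
    {k : Set α} (hk : IsCompact k) {H : α → β} (hH : Continuous H) {ε : ℝ} (hε : 0 < ε) :
    ∃ δ > 0, ∀ a ∈ k, ∀ b, dist b a < δ → dist (H b) (H a) < ε := by
  obtain ⟨δ, hδ, h⟩ := Metric.mem_uniformity_dist.1
    (hk.uniformContinuousAt_of_continuousAt H (fun a _ => hH.continuousAt)
      (Metric.dist_mem_uniformity hε))
  refine ⟨δ, hδ, fun a ha b hab => ?_⟩
  rw [dist_comm]
  exact h (a := a) (b := b) (by rwa [dist_comm]) ha

theorem gronwallBound_mul_left {K : ℝ} (hK : K ≠ 0) (r δ ε x : ℝ) :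
    gronwallBound (r * δ) K (r * ε) x = r * gronwallBound δ K ε x := by
  simp only [gronwallBound_of_K_ne_0 hK]
  ring

/-- Linear scalar ODEs depending continuously on a parameter have a solution which is jointly
continuous in the parameter and the variable. -/
theorem exists_continuous_linear_ode_solution {a b : ℝ → ℝ → ℝ} {p : ℝ → ℝ}
    (ha : Continuous fun q : ℝ × ℝ => a q.1 q.2) (hb : Continuous fun q : ℝ × ℝ => b q.1 q.2)
    (hp : Continuous p) :
    ∃ P : ℝ → ℝ → ℝ, (Continuous fun q : ℝ × ℝ => P q.1 q.2) ∧ (∀ x, P x 0 = p x) ∧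
      ∀ x y, HasDerivAt (P x) (a x y * P x y + b x y) y := by
  have prim : ∀ {c : ℝ → ℝ → ℝ}, (Continuous fun q : ℝ × ℝ => c q.1 q.2) →
      (Continuous fun q : ℝ × ℝ => ∫ t in (0:ℝ)..q.2, c q.1 t) ∧
      ∀ x y, HasDerivAt (fun y => ∫ t in (0:ℝ)..y, c x t) (c x y) y := by
    intro c hc
    refine ⟨intervalIntegral.continuous_parametric_intervalIntegral_of_continuous
      (f := fun (q : ℝ × ℝ) t => c q.1 t)
      (hc.comp (by fun_prop : Continuous fun r : (ℝ × ℝ) × ℝ => (r.1.1, r.2))) continuous_snd,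
      fun x y => ?_⟩
    exact ((hc.comp (by fun_prop : Continuous fun t : ℝ => (x, t))).integral_hasStrictDerivAt
      0 y).hasDerivAt
  obtain ⟨cA, dA⟩ := prim ha
  obtain ⟨cB, dB⟩ := prim (c := fun x y => Real.exp (-∫ t in (0:ℝ)..y, a x t) * b x y)
    (by fun_prop)
  refine ⟨fun x y => Real.exp (∫ t in (0:ℝ)..y, a x t) *
    (p x + ∫ s in (0:ℝ)..y, Real.exp (-∫ t in (0:ℝ)..s, a x t) * b x s), by fun_prop,
    by simp, fun x y => ?_⟩
  refine ((dA x y).exp.mul ((dB x y).const_add (p x))).congr_deriv ?_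
  rw [← mul_assoc (Real.exp _) (Real.exp _) (b x y), ← Real.exp_add, add_neg_cancel,
    Real.exp_zero]
  ring

/-- Differentiability in the parameter `x` of solutions of the ODE `∂_y U = G (U, V)`, when `V`
and the initial value of `U` are continuously differentiable in `x`. -/
theorem exists_continuous_parameter_deriv {T S : ℝ} (hT : 0 < T) {G : ℝ × ℝ → ℝ}
    {K : NNReal} (hG : ContDiff ℝ 1 G) (hGLip : LipschitzWith K G) {U V W : ℝ → ℝ → ℝ}
    {u : ℝ → ℝ} (hu : ContDiffOn ℝ 1 u (Icc 0 T))
    (cU : Continuous fun p : ℝ × ℝ => U p.1 p.2) (cV : Continuous fun p : ℝ × ℝ => V p.1 p.2)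
    (cW : Continuous fun p : ℝ × ℝ => W p.1 p.2)
    (dV : ∀ x ∈ Icc 0 T, ∀ y ∈ Icc 0 S,
      HasDerivWithinAt (fun x' => V x' y) (W x y) (Icc 0 T) x)
    (dU : ∀ x ∈ Icc 0 T, ∀ y ∈ Icc 0 S,
      HasDerivWithinAt (fun y' => U x y') (G (U x y, V x y)) (Icc 0 S) y)
    (iU : ∀ x ∈ Icc 0 T, U x 0 = u x) :
    ∃ P : ℝ → ℝ → ℝ, (Continuous fun p : ℝ × ℝ => P p.1 p.2) ∧
      ∀ x ∈ Icc 0 T, ∀ y ∈ Icc 0 S,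
        HasDerivWithinAt (fun x' => U x' y) (P x y) (Icc 0 T) x := by
  have cUV : Continuous fun p : ℝ × ℝ => (U p.1 p.2, V p.1 p.2) := cU.prodMk cV
  have cD : Continuous (fderiv ℝ G) := hG.continuous_fderiv one_ne_zero
  have cDUV := cD.comp cUV
  obtain ⟨du, cdu⟩ := (contDiffOn_one_iff_derivWithin (uniqueDiffOn_Icc hT)).1 hu
  obtain ⟨P, cP, iP, dP⟩ := exists_continuous_linear_ode_solution
    (a := fun x y => fderiv ℝ G (U x y, V x y) (1, 0))
    (b := fun x y => fderiv ℝ G (U x y, V x y) (0, W x y))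
    (p := fun x => derivWithin u (Icc 0 T) (projIcc 0 T hT.le x))
    (cDUV.clm_apply continuous_const) (cDUV.clm_apply (continuous_const.prodMk cW))
    (cdu.domRestrict.comp continuous_projIcc)
  refine ⟨P, cP, fun x hx y hy => ?_⟩
  rw [hasDerivWithinAt_iff_isLittleO, Asymptotics.isLittleO_iff]
  intro c hc
  obtain ⟨M, hM⟩ := (isCompact_Icc (a := 0) (b := S)).exists_bound_of_continuousOn
    ((cP.prodMk cW).comp (by fun_prop : Continuous fun t : ℝ => (x, t))).continuousOn
  set B := gronwallBound 1 (K + 1) (1 + M + K) y with hB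
  set ε := min 1 (c / (|B| + 1)) with hε
  have hε0 : 0 < ε := by positivity
  have hε1 : ε ≤ 1 := min_le_left _ _
  have hεB : ε * B ≤ c := by
    have h1 : ε * (|B| + 1) ≤ c := by
      rw [← le_div_iff₀ (by positivity)]
      exact min_le_right _ _
    nlinarith [le_abs_self B]
  have kx : IsCompact ((fun t => (x, t)) '' Icc 0 S) := isCompact_Icc.image (by fun_prop)
  obtain ⟨δ₁, hδ₁, h₁⟩ := (kx.image cUV).exists_uniform_delta cD hε0
  obtain ⟨δ₂, hδ₂, h₂⟩ := kx.exists_uniform_delta cUV hδ₁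
  obtain ⟨δ₃, hδ₃, h₃⟩ := kx.exists_uniform_delta cW hε0
  have hu' := Asymptotics.isLittleO_iff.1
    (hasDerivWithinAt_iff_isLittleO.1 (du x hx).hasDerivWithinAt) hε0
  filter_upwards [self_mem_nhdsWithin, mem_nhdsWithin_of_mem_nhds (Metric.ball_mem_nhds x hδ₂),
    mem_nhdsWithin_of_mem_nhds (Metric.ball_mem_nhds x hδ₃), hu'] with x' hx' hb₂ hb₃ hux'
  simp only [smul_eq_mul, Real.norm_eq_abs] at hux' ⊢
  have near : ∀ {s t δ : ℝ}, s ∈ Metric.ball x δ → dist (s, t) (x, t) < δ := by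
    intro s t δ hs
    simpa [Prod.dist_eq, Metric.pos_of_mem_ball hs] using hs
  have hV : ∀ t ∈ Icc 0 S, |V x' t - V x t - W x t * (x' - x)| ≤ ε * |x' - x| := fun t ht =>
    abs_sub_sub_mul_le_of_hasDerivWithinAt (φ := fun s => V s t) (φ' := fun s => W s t)
      (s := Icc 0 T ∩ Metric.ball x δ₃) ((convex_Icc _ _).inter (convex_ball _ _))
      (fun s hs => (dV s hs.1 t ht).mono inter_subset_left)
      (fun s hs => (h₃ (x, t) (mem_image_of_mem _ ht) (s, t) (near hs.2)).le)
      ⟨hx, Metric.mem_ball_self hδ₃⟩ ⟨hx', hb₃⟩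
  have bound : ∀ t ∈ Icc 0 S, |G (U x' t, V x' t) - G (U x t, V x t) -
      (x' - x) * (fderiv ℝ G (U x t, V x t) (1, 0) * P x t +
        fderiv ℝ G (U x t, V x t) (0, W x t))| ≤
      (K + 1) * |U x' t - U x t - (x' - x) * P x t| + ε * |x' - x| * (1 + M + K) := by
    intro t ht
    set q := (U x t, V x t) with hq
    set q' := (U x' t, V x' t) with hq'
    set L := fderiv ℝ G q with hL
    set r : ℝ × ℝ := (U x' t - U x t - (x' - x) * P x t, V x' t - V x t - W x t * (x' - x)) with hr
    have hqr : q' - q = r + (x' - x) • (P x t, W x t) := by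
      ext
      · simp [hq, hq', hr]
      · simp [hq, hq', hr]
        ring
    have hLr : (x' - x) * (L (1, 0) * P x t + L (0, W x t)) = L (q' - q) - L r := by
      have : (P x t, W x t) = P x t • ((1 : ℝ), (0 : ℝ)) + (0, W x t) := by simp
      rw [hqr, map_add, map_smul, this, map_add, map_smul]
      simp only [smul_eq_mul]
      ring
    have hrn : ‖r‖ ≤ |U x' t - U x t - (x' - x) * P x t| + ε * |x' - x| :=
      max_le (le_add_of_nonneg_right (by positivity))
        ((hV t ht).trans (le_add_of_nonneg_left (abs_nonneg _)))
    have hqn : ‖q' - q‖ ≤ ‖r‖ + |x' - x| * M := by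
      rw [hqr]
      refine (norm_add_le _ _).trans ?_
      rw [norm_smul, Real.norm_eq_abs]
      gcongr
      exact hM t ht
    have hGq : |G q' - G q - L (q' - q)| ≤ ε * ‖q' - q‖ :=
      (convex_ball q δ₁).norm_image_sub_le_of_norm_fderiv_le' (𝕜 := ℝ)
        (fun z _ => hG.differentiable one_ne_zero z)
        (fun z hz => by
          rw [← dist_eq_norm]
          exact (h₁ q (mem_image_of_mem _ (mem_image_of_mem _ ht)) z hz).le)
        (Metric.mem_ball_self hδ₁) (h₂ (x, t) (mem_image_of_mem _ ht) (x', t) (near hb₂))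
    have hLrn : |L r| ≤ K * ‖r‖ :=
      L.le_of_opNorm_le (norm_fderiv_le_of_lipschitz ℝ hGLip) r
    rw [hLr, show G q' - G q - (L (q' - q) - L r) = (G q' - G q - L (q' - q)) + L r by ring]
    have hK : (0 : ℝ) ≤ K := K.2
    calc |G q' - G q - L (q' - q) + L r| ≤ ε * (‖r‖ + |x' - x| * M) + K * ‖r‖ :=
          (abs_add_le _ _).trans (add_le_add (hGq.trans (by gcongr)) hLrn)
      _ = (ε + K) * ‖r‖ + ε * |x' - x| * M := by ring
      _ ≤ (1 + K) * (|U x' t - U x t - (x' - x) * P x t| + ε * |x' - x|)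
          + ε * |x' - x| * M := by gcongr
      _ = _ := by ring
  have dΔ : ∀ t ∈ Icc 0 S, HasDerivWithinAt (fun t => U x' t - U x t - (x' - x) * P x t) _
      (Icc 0 S) t := fun t ht =>
    ((dU x' hx' t ht).sub (dU x hx t ht)).sub ((dP x t).hasDerivWithinAt.const_mul (x' - x))
  have := norm_le_gronwallBound_of_norm_deriv_right_le (δ := ε * |x' - x| * 1)
    (fun t ht => (dΔ t ht).continuousWithinAt)
    (fun t ht => (dΔ t (Ico_subset_Icc_self ht)).Ici_of_Icc ht)
    (by simpa [iU x hx, iU x' hx', iP, projIcc_of_mem _ hx] using hux')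
    (fun t ht => bound t (Ico_subset_Icc_self ht)) y hy
  rw [gronwallBound_mul_left (by positivity), sub_zero, ← hB, Real.norm_eq_abs] at this
  calc |U x' y - U x y - (x' - x) * P x y| ≤ ε * |x' - x| * B := this
    _ = ε * B * |x' - x| := by ring
    _ ≤ c * |x' - x| := by gcongr

theorem goursat_nonlinear_hyperbolic_existence_uniqueness
    (x₀ y₀ : ℝ) (hx₀ : 0 < x₀) (hy₀ : 0 < y₀)
    (f g : ℝ → ℝ → ℝ) (Kf Kg : NNReal)
    (hf : ContDiff ℝ (⊤ : ℕ∞) (fun p : ℝ × ℝ => f p.1 p.2))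
    (hg : ContDiff ℝ (⊤ : ℕ∞) (fun p : ℝ × ℝ => g p.1 p.2))
    (hfLip : LipschitzWith Kf (fun p : ℝ × ℝ => f p.1 p.2))
    (hgLip : LipschitzWith Kg (fun p : ℝ × ℝ => g p.1 p.2))
    (U₀ V₀ : ℝ → ℝ)
    (hU₀ : ContDiffOn ℝ (⊤ : ℕ∞) U₀ (Set.Icc 0 x₀))
    (hV₀ : ContDiffOn ℝ (⊤ : ℕ∞) V₀ (Set.Icc 0 y₀)) :
    (∃ U V : ℝ → ℝ → ℝ, IsGoursatSolution x₀ y₀ f g U₀ V₀ U V) ∧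
    (∀ U V U' V' : ℝ → ℝ → ℝ,
      IsGoursatSolution x₀ y₀ f g U₀ V₀ U V →
      IsGoursatSolution x₀ y₀ f g U₀ V₀ U' V' →
      ∀ x ∈ Set.Icc (0:ℝ) x₀, ∀ y ∈ Set.Icc (0:ℝ) y₀,
        U x y = U' x y ∧ V x y = V' x y) := by
  refine ⟨?_, fun U V U' V' h h' => goursat_solution_unique hfLip hgLip h h'⟩
  obtain ⟨U, V, cU, cV, d, iU, iV⟩ := exists_continuous_goursat_solution hx₀ hy₀ hfLip hgLip
    hU₀.continuousOn hV₀.continuousOn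
  have cf : Continuous fun p : ℝ × ℝ => f (U p.1 p.2) (V p.1 p.2) :=
    hfLip.continuous.comp (cU.prodMk cV)
  have cg : Continuous fun p : ℝ × ℝ => g (U p.1 p.2) (V p.1 p.2) :=
    hgLip.continuous.comp (cU.prodMk cV)
  have one_le : (1 : WithTop ℕ∞) ≤ ((⊤ : ℕ∞) : WithTop ℕ∞) := by exact_mod_cast le_top
  obtain ⟨P, cP, dP⟩ := exists_continuous_parameter_deriv hx₀ (hg.of_le one_le) hgLip
    (hU₀.of_le one_le) cU cV cf (fun x hx y hy => (d x hx y hy).1)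
    (fun x hx y hy => (d x hx y hy).2) iU
  have swap : ∀ {H : ℝ → ℝ → ℝ}, (Continuous fun p : ℝ × ℝ => H p.1 p.2) →
      Continuous fun p : ℝ × ℝ => H p.2 p.1 := fun h => h.comp continuous_swap
  obtain ⟨Q, cQ, dQ⟩ := exists_continuous_parameter_deriv (G := fun p => f p.2 p.1)
    (U := fun y x => V x y) (V := fun y x => U x y) hy₀
    ((hf.of_le one_le).comp (contDiff_snd.prodMk contDiff_fst))
    (LipschitzWith.of_dist_le_mul fun p q => by
      simpa [Prod.dist_eq, max_comm] using hfLip.dist_le_mul p.swap q.swap)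
    (hV₀.of_le one_le) (swap cV) (swap cU)
    (swap (H := fun x y => g (U x y) (V x y)) cg) (fun y hy x hx => (d x hx y hy).2)
    (fun y hy x hx => (d x hx y hy).1) iV
  exact ⟨U, V, contDiffOn_one_rectangle hx₀ hy₀ cP cg dP fun x hx y hy => (d x hx y hy).2,
    contDiffOn_one_rectangle hx₀ hy₀ cf (swap cQ) (fun x hx y hy => (d x hx y hy).1)
      fun x hx y hy => dQ y hy x hx, d, iU, iV⟩
end

section
/- Let α, β : ℝ → ℝ be smooth functions with α(0) = β(0). Then there exists a unique smooth function φ : ℝ² → ℝ satisfying the sine-Gordon equation ∂ₓ∂_yφ(x,y) = sin(φ(x,y)) for all (x,y) ∈ ℝ², together with the boundary conditions φ(x,0) = α(x) for all x ∈ ℝ and φ(0,y) = β(y) for all y ∈ ℝ. -/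
namespace Goursat

open MeasureTheory Filter Topology Set

universe u

/-- Differentiation under an interval integral whose integrand and its derivative are jointly
continuous. -/
theorem hasFDerivAt_intervalIntegral_of_continuous {H E : Type u} [NormedAddCommGroup H]
    [NormedSpace ℝ H] [ProperSpace H] [NormedAddCommGroup E] [NormedSpace ℝ E]
    {f : H × ℝ → E} {f' : H × ℝ → H →L[ℝ] E} (hf : Continuous f) (hf' : Continuous f')
    (hd : ∀ x t, HasFDerivAt (fun x => f (x, t)) (f' (x, t)) x) (a b : ℝ) (x : H) :
    HasFDerivAt (fun x => ∫ t in a..b, f (x, t)) (∫ t in a..b, f' (x, t)) x := by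
  obtain ⟨C, hC⟩ := ((isCompact_closedBall x 1).prod
    (isCompact_uIcc (a := a) (b := b))).exists_bound_of_continuousOn hf'.continuousOn
  refine intervalIntegral.hasFDerivAt_integral_of_dominated_of_fderiv_le
    (F := fun x t => f (x, t)) (F' := fun x t => f' (x, t)) (bound := fun _ => C)
    (Metric.closedBall_mem_nhds x one_pos) (Eventually.of_forall fun z => ?_) ?_ ?_ ?_
    (by simp) ?_
  · exact (hf.comp (Continuous.prodMk_right z)).aestronglyMeasurable
  · exact (hf.comp (Continuous.prodMk_right x)).intervalIntegrable _ _
  · exact (hf'.comp (Continuous.prodMk_right x)).aestronglyMeasurable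
  · exact Eventually.of_forall fun t ht z hz => hC (z, t) ⟨hz, uIoc_subset_uIcc ht⟩
  · exact Eventually.of_forall fun t _ z _ => hd z t

theorem contDiff_intervalIntegral {H E : Type u} [NormedAddCommGroup H] [NormedSpace ℝ H]
    [ProperSpace H] [NormedAddCommGroup E] [NormedSpace ℝ E] (n : ℕ) {f : H × ℝ → E}
    (hf : ContDiff ℝ n f) (a b : ℝ) : ContDiff ℝ n fun x => ∫ t in a..b, f (x, t) := by
  induction n generalizing E with
  | zero =>
    rw [Nat.cast_zero, contDiff_zero] at hf ⊢
    exact intervalIntegral.continuous_parametric_intervalIntegral_of_continuous'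
      (f := fun x t => f (x, t)) hf a b
  | succ n ih =>
    have hf1 : ContDiff ℝ (n + 1) f := by exact_mod_cast hf
    have hf' : ContDiff ℝ n fun p : H × ℝ =>
        (fderiv ℝ f p).comp (ContinuousLinearMap.inl ℝ H ℝ) :=
      (hf1.fderiv_right le_rfl).clm_comp contDiff_const
    rw [Nat.cast_add, Nat.cast_one]
    refine contDiff_succ_iff_hasFDerivAt.2 ⟨_, ih hf', fun x => ?_⟩
    refine hasFDerivAt_intervalIntegral_of_continuous hf.continuous hf'.continuous
      (fun x t => ?_) a b x
    exact ((hf1.differentiable (by simp)) (x, t)).hasFDerivAt.comp x (hasFDerivAt_prodMk_left x t)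

theorem contDiff_parametric_primitive {H E : Type u} [NormedAddCommGroup H] [NormedSpace ℝ H]
    [ProperSpace H] [NormedAddCommGroup E] [NormedSpace ℝ E] {n : ℕ} {f : H → ℝ → E} {g : H → ℝ}
    (hf : ContDiff ℝ n fun p : H × ℝ => f p.1 p.2) (hg : ContDiff ℝ n g) :
    ContDiff ℝ n fun p : H => ∫ t in (0 : ℝ)..g p, f p t := by
  have h (p : H) : ∫ t in (0 : ℝ)..g p, f p t = g p • ∫ u in (0 : ℝ)..1, f p (g p * u) := by
    rw [intervalIntegral.smul_integral_comp_mul_left, mul_zero, mul_one]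
  simp_rw [h]
  refine hg.smul (contDiff_intervalIntegral n (f := fun q : H × ℝ => f q.1 (g q.1 * q.2)) ?_ 0 1)
  exact hf.comp (contDiff_fst.prodMk ((hg.comp contDiff_fst).mul contDiff_snd))

theorem contDiff_succ_of_partial {n : ℕ} {f f₁ f₂ : ℝ × ℝ → ℝ} (h₁ : ContDiff ℝ n f₁)
    (h₂ : ContDiff ℝ n f₂) (hd₁ : ∀ x y, HasDerivAt (fun x => f (x, y)) (f₁ (x, y)) x)
    (hd₂ : ∀ x y, HasDerivAt (fun y => f (x, y)) (f₂ (x, y)) y) :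
    ContDiff ℝ (n + 1) f := by
  let L : ℝ →L[ℝ] ℝ →L[ℝ] ℝ := ContinuousLinearMap.toSpanSingletonCLE.toContinuousLinearMap
  have hL₁ := L.contDiff.comp h₁
  have hL₂ := L.contDiff.comp h₂
  refine contDiff_succ_iff_hasFDerivAt.2
    ⟨fun p => (L (f₁ p)).coprod (L (f₂ p)), ?_, fun p => ?_⟩
  · simp only [← ContinuousLinearMap.comp_fst_add_comp_snd]
    exact (hL₁.clm_comp contDiff_const).add (hL₂.clm_comp contDiff_const)
  · exact (hasStrictFDerivAt_uncurry_coprod (f := fun x y => f (x, y))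
      (f₁ := fun x y => L (f₁ (x, y))) (f₂ := fun x y => L (f₂ (x, y)))
      (Eventually.of_forall fun v => (hd₁ v.1 v.2).hasFDerivAt)
      (Eventually.of_forall fun v => (hd₂ v.1 v.2).hasFDerivAt)
      hL₁.continuous.continuousAt hL₂.continuous.continuousAt).hasFDerivAt

/-- The integral of `f` over the oriented rectangle with opposite corners `(0, 0)` and `p`. -/
noncomputable def rectIntegral (f : ℝ × ℝ → ℝ) (p : ℝ × ℝ) : ℝ :=
  ∫ t in (0 : ℝ)..p.2, ∫ s in (0 : ℝ)..p.1, f (s, t)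

theorem continuous_innerIntegral {f : ℝ × ℝ → ℝ} (hf : Continuous f) :
    Continuous fun p : ℝ × ℝ => ∫ s in (0 : ℝ)..p.1, f (s, p.2) :=
  intervalIntegral.continuous_parametric_intervalIntegral_of_continuous
    (f := fun p s => f (s, p.2)) (hf.comp (by fun_prop)) continuous_fst

theorem continuous_rectIntegral {f : ℝ × ℝ → ℝ} (hf : Continuous f) :
    Continuous (rectIntegral f) :=
  intervalIntegral.continuous_parametric_intervalIntegral_of_continuous
    (f := fun (p : ℝ × ℝ) t => ∫ s in (0 : ℝ)..p.1, f (s, t))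
    ((continuous_innerIntegral hf).comp
      (by fun_prop : Continuous fun q : (ℝ × ℝ) × ℝ => (q.1.1, q.2))) continuous_snd

theorem hasDerivAt_integral_upper {f : ℝ → ℝ} (hf : Continuous f) (x : ℝ) :
    HasDerivAt (fun x => ∫ s in (0 : ℝ)..x, f s) (f x) x :=
  intervalIntegral.integral_hasDerivAt_right (hf.intervalIntegrable _ _)
    (hf.stronglyMeasurableAtFilter _ _) hf.continuousAt

theorem hasDerivAt_rectIntegral_snd {f : ℝ × ℝ → ℝ} (hf : Continuous f) (x y : ℝ) :
    HasDerivAt (fun y => rectIntegral f (x, y)) (∫ s in (0 : ℝ)..x, f (s, y)) y :=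
  hasDerivAt_integral_upper ((continuous_innerIntegral hf).comp (Continuous.prodMk_right x)) y

theorem hasDerivAt_rectIntegral_fst {f : ℝ × ℝ → ℝ} (hf : Continuous f) (x y : ℝ) :
    HasDerivAt (fun x => rectIntegral f (x, y)) (∫ t in (0 : ℝ)..y, f (x, t)) x := by
  let L : ℝ →L[ℝ] ℝ →L[ℝ] ℝ := ContinuousLinearMap.toSpanSingletonCLE.toContinuousLinearMap
  have h := hasFDerivAt_intervalIntegral_of_continuous (continuous_innerIntegral hf)
    (L.continuous.comp hf)
    (fun x t => (hasDerivAt_integral_upper (hf.comp (Continuous.prodMk_left t)) x).hasFDerivAt)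
    0 y x
  have hc : IntervalIntegrable (fun t => f (x, t)) volume 0 y :=
    (hf.comp (Continuous.prodMk_right x)).intervalIntegrable _ _
  have := L.intervalIntegral_comp_comm hc
  simp only [Function.comp_apply] at h
  rw [this] at h
  exact hasDerivAt_iff_hasFDerivAt.2 h

/-- The weight with respect to which integration over rectangles is a contraction. -/
noncomputable def weight (p : ℝ × ℝ) : ℝ := Real.exp (2 * |p.2|) * Real.exp (2 * |p.1|)

theorem weight_pos (p : ℝ × ℝ) : 0 < weight p := by unfold weight; positivity

theorem one_le_weight (p : ℝ × ℝ) : 1 ≤ weight p :=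
  one_le_mul_of_one_le_of_one_le (Real.one_le_exp (by positivity)) (Real.one_le_exp (by positivity))

theorem continuous_weight : Continuous weight := by unfold weight; fun_prop

theorem abs_integral_le_exp_of_nonneg {f : ℝ → ℝ} {C x : ℝ} (hC : 0 ≤ C)
    (hf : ∀ s, |f s| ≤ C * Real.exp (2 * |s|)) (hx : 0 ≤ x) :
    |∫ s in (0 : ℝ)..x, f s| ≤ C / 2 * Real.exp (2 * |x|) := by
  have h_int : ∫ s in (0 : ℝ)..x, C * Real.exp (2 * s) = C / 2 * (Real.exp (2 * x) - 1) := by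
    rw [intervalIntegral.integral_const_mul, intervalIntegral.integral_comp_mul_left _ two_ne_zero,
      integral_exp]
    simp
    ring
  have h := intervalIntegral.norm_integral_le_of_norm_le (f := f) (μ := volume)
    (g := fun s => C * Real.exp (2 * s)) hx
    (Eventually.of_forall fun s hs => by simpa [abs_of_pos hs.1] using hf s)
    (Continuous.intervalIntegrable (by fun_prop) _ _)
  rw [h_int, Real.norm_eq_abs] at h
  rw [abs_of_nonneg hx]
  linarith

theorem abs_integral_le_exp {f : ℝ → ℝ} {C : ℝ} (hC : 0 ≤ C)
    (hf : ∀ s, |f s| ≤ C * Real.exp (2 * |s|)) (x : ℝ) :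
    |∫ s in (0 : ℝ)..x, f s| ≤ C / 2 * Real.exp (2 * |x|) := by
  rcases le_total 0 x with hx | hx
  · exact abs_integral_le_exp_of_nonneg hC hf hx
  · have h := abs_integral_le_exp_of_nonneg (f := fun s => f (-s)) (x := -x) hC
      (fun s => by simpa using hf (-s)) (by linarith)
    rwa [intervalIntegral.integral_comp_neg, neg_neg, neg_zero, intervalIntegral.integral_symm,
      abs_neg, abs_neg] at h

theorem abs_rectIntegral_le {f : ℝ × ℝ → ℝ} {C : ℝ} (hC : 0 ≤ C)
    (hf : ∀ p, |f p| ≤ C * weight p) (p : ℝ × ℝ) :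
    |rectIntegral f p| ≤ C / 4 * weight p := by
  have h (t : ℝ) := abs_integral_le_exp (f := fun s => f (s, t))
    (C := C * Real.exp (2 * |t|)) (by positivity)
    (fun s => (hf (s, t)).trans_eq (by simp [weight, mul_assoc])) p.1
  refine (abs_integral_le_exp (C := C / 2 * Real.exp (2 * |p.1|)) (by positivity)
    (fun t => (h t).trans_eq (by ring)) p.2).trans_eq ?_
  unfold weight
  ring

theorem rectIntegral_sub {f g : ℝ × ℝ → ℝ} (hf : Continuous f) (hg : Continuous g) (p : ℝ × ℝ) :
    rectIntegral f p - rectIntegral g p = rectIntegral (fun q => f q - g q) p := by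
  have hi {h : ℝ × ℝ → ℝ} (hh : Continuous h) :
      Continuous fun t => ∫ s in (0 : ℝ)..p.1, h (s, t) :=
    (continuous_innerIntegral hh).comp (Continuous.prodMk_right p.1)
  have hs {h : ℝ × ℝ → ℝ} (hh : Continuous h) (t : ℝ) : Continuous fun s => h (s, t) :=
    hh.comp (Continuous.prodMk_left t)
  unfold rectIntegral
  rw [← intervalIntegral.integral_sub ((hi hf).intervalIntegrable _ _)
    ((hi hg).intervalIntegrable _ _)]
  refine intervalIntegral.integral_congr fun t _ => ?_
  exact (intervalIntegral.integral_sub ((hs hf t).intervalIntegrable _ _)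
    ((hs hg t).intervalIntegrable _ _)).symm

theorem abs_rectIntegral_sin_sub_le {φ ψ : ℝ × ℝ → ℝ} (hφ : Continuous φ) (hψ : Continuous ψ)
    {C : ℝ} (hC : 0 ≤ C) (h : ∀ p, |φ p - ψ p| ≤ C * weight p) (p : ℝ × ℝ) :
    |rectIntegral (fun q => Real.sin (φ q)) p - rectIntegral (fun q => Real.sin (ψ q)) p| ≤
      C / 4 * weight p := by
  rw [rectIntegral_sub (by fun_prop) (by fun_prop)]
  exact abs_rectIntegral_le hC (fun q => (Real.abs_sin_sub_sin_le _ _).trans (h q)) p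

theorem abs_rectIntegral_sin_le (φ : ℝ × ℝ → ℝ) (p : ℝ × ℝ) :
    |rectIntegral (fun q => Real.sin (φ q)) p| ≤ weight p := by
  have := abs_rectIntegral_le (f := fun q => Real.sin (φ q)) zero_le_one
    (fun q => (Real.abs_sin_le_one _).trans (by simpa using one_le_weight q)) p
  linarith [weight_pos p]

theorem eq_of_integral_eq {w φ ψ : ℝ × ℝ → ℝ} (hφ : Continuous φ) (hψ : Continuous ψ)
    (hφw : ∀ p, φ p = w p + rectIntegral (fun q => Real.sin (φ q)) p)
    (hψw : ∀ p, ψ p = w p + rectIntegral (fun q => Real.sin (ψ q)) p) : φ = ψ := by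
  have hsub (p : ℝ × ℝ) : φ p - ψ p = rectIntegral (fun q => Real.sin (φ q)) p -
      rectIntegral (fun q => Real.sin (ψ q)) p := by
    rw [hφw p, hψw p]
    ring
  have h (n : ℕ) : ∀ p, |φ p - ψ p| ≤ 2 * (1 / 4) ^ n * weight p := by
    induction n with
    | zero =>
      intro p
      rw [hsub]
      refine (abs_sub _ _).trans ?_
      linarith [abs_rectIntegral_sin_le φ p, abs_rectIntegral_sin_le ψ p]
    | succ n ih =>
      intro p
      rw [hsub]
      refine (abs_rectIntegral_sin_sub_le hφ hψ (by positivity) ih p).trans_eq ?_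
      ring
  funext p
  have hlim : Tendsto (fun n : ℕ => 2 * (1 / 4 : ℝ) ^ n * weight p) atTop (𝓝 0) := by
    simpa using ((tendsto_pow_atTop_nhds_zero_of_lt_one (r := (1 / 4 : ℝ)) (by norm_num)
      (by norm_num)).const_mul 2).mul_const (weight p)
  exact sub_eq_zero.1 (abs_nonpos_iff.1 (ge_of_tendsto' hlim fun n => h n p))

open scoped BoundedContinuousFunction in
theorem exists_integral_eq {w : ℝ × ℝ → ℝ} (hw : Continuous w) :
    ∃ φ : ℝ × ℝ → ℝ, Continuous φ ∧
      ∀ p, φ p = w p + rectIntegral (fun q => Real.sin (φ q)) p := by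
  let Φ (g : (ℝ × ℝ) →ᵇ ℝ) (p : ℝ × ℝ) : ℝ := w p + weight p * g p
  have hΦ (g : (ℝ × ℝ) →ᵇ ℝ) : Continuous (Φ g) :=
    hw.add (continuous_weight.mul g.continuous)
  let T (g : (ℝ × ℝ) →ᵇ ℝ) : (ℝ × ℝ) →ᵇ ℝ := BoundedContinuousFunction.ofNormedAddCommGroup
    (fun p => rectIntegral (fun q => Real.sin (Φ g q)) p / weight p)
    ((continuous_rectIntegral (Real.continuous_sin.comp (hΦ g))).div continuous_weight
      fun p => (weight_pos p).ne') 1 fun p => by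
        rw [Real.norm_eq_abs, abs_div, abs_of_pos (weight_pos p)]
        exact div_le_one_of_le₀ (abs_rectIntegral_sin_le _ p) (weight_pos p).le
  have hT : ContractingWith (1 / 4) T := by
    refine ⟨by norm_num, LipschitzWith.of_dist_le_mul fun g h => ?_⟩
    refine (BoundedContinuousFunction.dist_le (by positivity)).2 fun p => ?_
    have key := abs_rectIntegral_sin_sub_le (hΦ g) (hΦ h) (dist_nonneg (x := g) (y := h))
      (fun q => by
        have hq := BoundedContinuousFunction.dist_coe_le_dist (f := g) (g := h) q
        rw [Real.dist_eq] at hq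
        simp only [Φ]
        rw [add_sub_add_left_eq_sub, ← mul_sub, abs_mul, abs_of_pos (weight_pos q), mul_comm]
        exact mul_le_mul_of_nonneg_right hq (weight_pos q).le) p
    change |rectIntegral (fun q => Real.sin (Φ g q)) p / weight p -
      rectIntegral (fun q => Real.sin (Φ h q)) p / weight p| ≤ _
    rw [← sub_div, abs_div, abs_of_pos (weight_pos p), div_le_iff₀ (weight_pos p)]
    refine key.trans_eq ?_
    push_cast
    ring
  refine ⟨Φ (hT.fixedPoint T), hΦ _, fun p => ?_⟩
  have hfix : hT.fixedPoint T p =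
      rectIntegral (fun q => Real.sin (Φ (hT.fixedPoint T) q)) p / weight p :=
    DFunLike.congr_fun (hT.fixedPoint_isFixedPt (f := T)).symm p
  rw [eq_div_iff (weight_pos p).ne', mul_comm] at hfix
  rw [← hfix]

theorem contDiff_of_integral_eq {α β : ℝ → ℝ} {c : ℝ} (hα : ContDiff ℝ (⊤ : ℕ∞) α)
    (hβ : ContDiff ℝ (⊤ : ℕ∞) β) {φ : ℝ × ℝ → ℝ} (hφ : Continuous φ)
    (h : ∀ p, φ p = α p.1 + β p.2 - c + rectIntegral (fun q => Real.sin (φ q)) p) :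
    ContDiff ℝ (⊤ : ℕ∞) φ := by
  have hs : Continuous fun q => Real.sin (φ q) := by fun_prop
  have hα' : ContDiff ℝ (⊤ : ℕ∞) (deriv α) := (contDiff_infty_iff_deriv.1 hα).2
  have hβ' : ContDiff ℝ (⊤ : ℕ∞) (deriv β) := (contDiff_infty_iff_deriv.1 hβ).2
  refine contDiff_infty.2 fun n => ?_
  induction n with
  | zero => simpa using hφ
  | succ n ih =>
    have hs' : ContDiff ℝ n fun q => Real.sin (φ q) := Real.contDiff_sin.comp ih
    have h₁ : ContDiff ℝ n (deriv α) := contDiff_infty.1 hα' n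
    have h₂ : ContDiff ℝ n (deriv β) := contDiff_infty.1 hβ' n
    have hv₁ : ContDiff ℝ n fun q : (ℝ × ℝ) × ℝ => (q.1.1, q.2) := by fun_prop
    have hv₂ : ContDiff ℝ n fun q : (ℝ × ℝ) × ℝ => (q.2, q.1.2) := by fun_prop
    have hI₁ : ContDiff ℝ n fun p : ℝ × ℝ => ∫ t in (0 : ℝ)..p.2, Real.sin (φ (p.1, t)) :=
      contDiff_parametric_primitive (f := fun (p : ℝ × ℝ) t => Real.sin (φ (p.1, t)))
        (hs'.comp hv₁) contDiff_snd
    have hI₂ : ContDiff ℝ n fun p : ℝ × ℝ => ∫ s in (0 : ℝ)..p.1, Real.sin (φ (s, p.2)) :=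
      contDiff_parametric_primitive (f := fun (p : ℝ × ℝ) s => Real.sin (φ (s, p.2)))
        (hs'.comp hv₂) contDiff_fst
    rw [Nat.cast_add, Nat.cast_one]
    refine contDiff_succ_of_partial
      (f₁ := fun p => deriv α p.1 + ∫ t in (0 : ℝ)..p.2, Real.sin (φ (p.1, t)))
      (f₂ := fun p => deriv β p.2 + ∫ s in (0 : ℝ)..p.1, Real.sin (φ (s, p.2))) ?_ ?_ ?_ ?_
    · exact (h₁.comp contDiff_fst).add hI₁
    · exact (h₂.comp contDiff_snd).add hI₂
    · intro x y
      have hd := (((hα.differentiable (by simp) x).hasDerivAt.add_const (β y)).sub_const c).add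
        (hasDerivAt_rectIntegral_fst hs x y)
      exact hd.congr_of_eventuallyEq (Eventually.of_forall fun x => h (x, y))
    · intro x y
      have hd := (((hβ.differentiable (by simp) y).hasDerivAt.const_add (α x)).sub_const c).add
        (hasDerivAt_rectIntegral_snd hs x y)
      exact hd.congr_of_eventuallyEq (Eventually.of_forall fun y => h (x, y))

theorem mixed_deriv_of_integral_eq {α β : ℝ → ℝ} {c : ℝ} (hβ : Differentiable ℝ β)
    {φ : ℝ × ℝ → ℝ} (hφ : Continuous φ)
    (h : ∀ p, φ p = α p.1 + β p.2 - c + rectIntegral (fun q => Real.sin (φ q)) p) (x y : ℝ) :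
    deriv (fun x' => deriv (fun y' => φ (x', y')) y) x = Real.sin (φ (x, y)) := by
  have hs : Continuous fun q => Real.sin (φ q) := by fun_prop
  have hy (x : ℝ) : deriv (fun y' => φ (x, y')) y =
      deriv β y + ∫ s in (0 : ℝ)..x, Real.sin (φ (s, y)) := by
    have hd := (((hβ y).hasDerivAt.const_add (α x)).sub_const c).add
      (hasDerivAt_rectIntegral_snd hs x y)
    exact (hd.congr_of_eventuallyEq (Eventually.of_forall fun y => h (x, y))).deriv
  simp_rw [hy]
  exact ((hasDerivAt_integral_upper (hs.comp (Continuous.prodMk_left y)) x).const_add _).deriv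

theorem integral_eq_of_mixed_deriv {φ : ℝ × ℝ → ℝ} (hφ : ContDiff ℝ (⊤ : ℕ∞) φ)
    (h : ∀ x y, deriv (fun x' => deriv (fun y' => φ (x', y')) y) x = Real.sin (φ (x, y)))
    (p : ℝ × ℝ) :
    φ p = φ (p.1, 0) + φ (0, p.2) - φ (0, 0) + rectIntegral (fun q => Real.sin (φ q)) p := by
  have hs : Continuous fun q => Real.sin (φ q) := by have := hφ.continuous; fun_prop
  let φ₂ (q : ℝ × ℝ) : ℝ := fderiv ℝ φ q (0, 1)
  have hφ₂ : ContDiff ℝ (⊤ : ℕ∞) φ₂ := (hφ.fderiv_right (by simp)).clm_apply contDiff_const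
  have hd (x y : ℝ) : HasDerivAt (fun y' => φ (x, y')) (φ₂ (x, y)) y :=
    ((hφ.differentiable (by simp)) (x, y)).hasFDerivAt.comp_hasDerivAt y
      ((hasDerivAt_const y x).prodMk (hasDerivAt_id y))
  simp_rw [fun x y => (hd x y).deriv] at h
  have hinner (y : ℝ) : ∫ s in (0 : ℝ)..p.1, Real.sin (φ (s, y)) = φ₂ (p.1, y) - φ₂ (0, y) := by
    have hdiff : Differentiable ℝ fun x => φ₂ (x, y) :=
      (hφ₂.differentiable (by simp)).comp (by fun_prop)
    refine intervalIntegral.integral_eq_sub_of_hasDerivAt (f := fun x => φ₂ (x, y))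
      (fun x _ => ?_) ((hs.comp (Continuous.prodMk_left y)).intervalIntegrable _ _)
    exact h x y ▸ (hdiff x).hasDerivAt
  have hcont (x : ℝ) : Continuous fun y => φ₂ (x, y) :=
    hφ₂.continuous.comp (Continuous.prodMk_right x)
  have houter (x : ℝ) : ∫ t in (0 : ℝ)..p.2, φ₂ (x, t) = φ (x, p.2) - φ (x, 0) :=
    intervalIntegral.integral_eq_sub_of_hasDerivAt (f := fun y => φ (x, y))
      (fun y _ => hd x y) ((hcont x).intervalIntegrable _ _)
  unfold rectIntegral
  simp_rw [hinner]
  rw [intervalIntegral.integral_sub ((hcont _).intervalIntegrable _ _)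
    ((hcont _).intervalIntegrable _ _), houter, houter]
  ring

end Goursat

/-- The Goursat (characteristic initial value) problem for the sine-Gordon equation:
given smooth functions `α, β : ℝ → ℝ` with `α 0 = β 0`, there is a unique smooth
`φ : ℝ² → ℝ` with `∂ₓ∂_yφ = sin φ`, `φ(x,0) = α(x)` and `φ(0,y) = β(y)`. -/
theorem sineGordon_goursat_existence_uniqueness
    (α β : ℝ → ℝ) (hα : ContDiff ℝ (⊤ : ℕ∞) α) (hβ : ContDiff ℝ (⊤ : ℕ∞) β) (h0 : α 0 = β 0) :
    ∃! φ : ℝ → ℝ → ℝ,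
      ContDiff ℝ (⊤ : ℕ∞) (fun p : ℝ × ℝ => φ p.1 p.2) ∧
      (∀ x y : ℝ, deriv (fun x' => deriv (fun y' => φ x' y') y) x = Real.sin (φ x y)) ∧
      (∀ x : ℝ, φ x 0 = α x) ∧
      (∀ y : ℝ, φ 0 y = β y) := by
  have h_int {φ : ℝ → ℝ → ℝ} (hφ : ContDiff ℝ (⊤ : ℕ∞) (fun p : ℝ × ℝ => φ p.1 p.2))
      (hpde : ∀ x y : ℝ, deriv (fun x' => deriv (fun y' => φ x' y') y) x = Real.sin (φ x y))
      (hx : ∀ x, φ x 0 = α x) (hy : ∀ y, φ 0 y = β y) (p : ℝ × ℝ) :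
      φ p.1 p.2 = α p.1 + β p.2 - α 0 + Goursat.rectIntegral (fun q => Real.sin (φ q.1 q.2)) p := by
    have h := Goursat.integral_eq_of_mixed_deriv hφ hpde p
    rwa [hx, hy, hx] at h
  have hα' := hα.continuous
  have hβ' := hβ.continuous
  obtain ⟨φ, hφ, h⟩ := Goursat.exists_integral_eq (w := fun p => α p.1 + β p.2 - α 0) (by fun_prop)
  have hsmooth := Goursat.contDiff_of_integral_eq hα hβ hφ h
  refine ⟨fun x y => φ (x, y), ⟨hsmooth,
    Goursat.mixed_deriv_of_integral_eq (hβ.differentiable (by simp)) hφ h, fun x => ?_, fun y => ?_⟩, ?_⟩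
  · beta_reduce
    rw [h]
    simp [Goursat.rectIntegral, h0]
  · beta_reduce
    rw [h]
    simp [Goursat.rectIntegral]
  · rintro ψ ⟨hψ, hpde, hx, hy⟩
    have heq := Goursat.eq_of_integral_eq hψ.continuous hφ (h_int hψ hpde hx hy) h
    funext x y
    exact congrFun heq (x, y)
end
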